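/- arXiv:1204.1311 — 8 statements merged into one kernel-verified Lean document; each statement's English description precedes it below -/
import Mathlib

section
/- Let E be a Courant algebroid over A (algebraic form) with an orthogonal splitting E = E₁ ⊕ E₂, and set ∇→_a β := pr₂(a⋄β), ∇←_β a := pr₁(β⋄a). Then these connections preserve the inner products: for all a, b ∈ E₁ and α, β ∈ E₂, ρ(α)⟨a,b⟩ = ⟨∇←_α a, b⟩ + ⟨a, ∇←_α b⟩ and ρ(a)⟨α,β⟩ = ⟨∇→_a α, β⟩ + ⟨α, ∇→_a β⟩. -/
/-- A Courant algebroid over a commutative ℝ-algebra `A` (algebraic form):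
an `A`-module `E` with a symmetric nondegenerate `A`-bilinear form, an `A`-linear
anchor into the ℝ-linear derivations of `A`, an ℝ-bilinear Dorfman bracket, and
an ℝ-linear map `Dop : A → E`, satisfying the Courant algebroid axioms. -/
structure CourantAlgebroid (A : Type*) [CommRing A] [Algebra ℝ A]
    (E : Type*) [AddCommGroup E] [Module ℝ E] [Module A E] [IsScalarTower ℝ A E] where
  ip : E →ₗ[A] E →ₗ[A] A
  ip_symm : ∀ φ ψ : E, ip φ ψ = ip ψ φ
  ip_nondeg : ∀ φ : E, (∀ ψ : E, ip φ ψ = 0) → φ = 0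
  anchor : E →ₗ[A] Derivation ℝ A A
  dia : E →ₗ[ℝ] E →ₗ[ℝ] E
  Dop : A →ₗ[ℝ] E
  ip_Dop : ∀ (f : A) (φ : E), ip (Dop f) φ = anchor φ f
  jacobi : ∀ φ φ₁ φ₂ : E,
    dia φ (dia φ₁ φ₂) = dia (dia φ φ₁) φ₂ + dia φ₁ (dia φ φ₂)
  leibniz : ∀ (φ φ' : E) (f : A),
    dia φ (f • φ') = (anchor φ f) • φ' + f • dia φ φ'
  sym_part : ∀ φ : E, dia φ φ = (2⁻¹ : ℝ) • Dop (ip φ φ)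
  ad_invar : ∀ φ φ' : E, anchor φ (ip φ' φ') = 2 * ip (dia φ φ') φ'

/-- An orthogonal splitting `E = E₁ ⊕ E₂` of a Courant algebroid: `A`-submodules
forming an internal direct sum, each being the orthogonal complement of the other,
together with the corresponding projections. -/
structure OrthSplitting {A : Type*} [CommRing A] [Algebra ℝ A]
    {E : Type*} [AddCommGroup E] [Module ℝ E] [Module A E] [IsScalarTower ℝ A E]
    (C : CourantAlgebroid A E) where
  E₁ : Submodule A E
  E₂ : Submodule A E
  indep : E₁ ⊓ E₂ = ⊥
  spans : E₁ ⊔ E₂ = ⊤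
  mem_E₂_iff : ∀ ψ : E, ψ ∈ E₂ ↔ ∀ φ ∈ E₁, C.ip φ ψ = 0
  mem_E₁_iff : ∀ ψ : E, ψ ∈ E₁ ↔ ∀ φ ∈ E₂, C.ip φ ψ = 0
  pr₁ : E →ₗ[A] E
  pr₂ : E →ₗ[A] E
  pr₁_mem : ∀ x : E, pr₁ x ∈ E₁
  pr₂_mem : ∀ x : E, pr₂ x ∈ E₂
  pr_sum : ∀ x : E, pr₁ x + pr₂ x = x

/-- Polarized form of the invariance axiom (C4). -/
theorem CourantAlgebroid.ad_invar_polar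
    {A : Type*} [CommRing A] [Algebra ℝ A]
    {E : Type*} [AddCommGroup E] [Module ℝ E] [Module A E] [IsScalarTower ℝ A E]
    (C : CourantAlgebroid A E) (φ x y : E) :
    C.anchor φ (C.ip x y) = C.ip (C.dia φ x) y + C.ip x (C.dia φ y) := by
  have h := C.ad_invar φ (x + y)
  have hx := C.ad_invar φ x
  have hy := C.ad_invar φ y
  simp only [map_add, LinearMap.add_apply] at h
  rw [C.ip_symm y x] at h
  rw [C.ip_symm x (C.dia φ y)]
  have h2 : (2 : A) * C.anchor φ (C.ip x y)
      = 2 * (C.ip (C.dia φ x) y + C.ip (C.dia φ y) x) := by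
    linear_combination h - hx - hy
  have hu : algebraMap ℝ A 2⁻¹ * 2 = 1 := by
    have : (2 : A) = algebraMap ℝ A 2 := (map_ofNat (algebraMap ℝ A) 2).symm
    rw [this, ← map_mul]
    norm_num
  have h3 := congrArg (fun z => algebraMap ℝ A 2⁻¹ * z) h2
  simpa only [← mul_assoc, hu, one_mul] using h3

/-- The induced connections `∇→_a β := pr₂(a⋄β)` and `∇←_β a := pr₁(β⋄a)` preserve
the inner products on `E₁` and `E₂`. -/
theorem connections_preserve_inner_products
    {A : Type*} [CommRing A] [Algebra ℝ A]
    {E : Type*} [AddCommGroup E] [Module ℝ E] [Module A E] [IsScalarTower ℝ A E]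
    (C : CourantAlgebroid A E) (S : OrthSplitting C) :
    ∀ (a b α β : E), a ∈ S.E₁ → b ∈ S.E₁ → α ∈ S.E₂ → β ∈ S.E₂ →
      C.anchor α (C.ip a b)
        = C.ip (S.pr₁ (C.dia α a)) b + C.ip a (S.pr₁ (C.dia α b)) ∧
      C.anchor a (C.ip α β)
        = C.ip (S.pr₂ (C.dia a α)) β + C.ip α (S.pr₂ (C.dia a β)) := by
  intro a b α β ha hb hα hβ
  have o12 : ∀ x ∈ S.E₁, ∀ y ∈ S.E₂, C.ip x y = 0 :=
    fun x hx y hy => (S.mem_E₂_iff y).1 hy x hx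
  have o21 : ∀ x ∈ S.E₂, ∀ y ∈ S.E₁, C.ip x y = 0 :=
    fun x hx y hy => (S.mem_E₁_iff y).1 hy x hx
  constructor
  · rw [C.ad_invar_polar]
    conv_lhs => rw [← S.pr_sum (C.dia α a), ← S.pr_sum (C.dia α b)]
    simp only [map_add, LinearMap.add_apply]
    rw [o21 _ (S.pr₂_mem _) b hb, o12 a ha _ (S.pr₂_mem _), add_zero, add_zero]
  · rw [C.ad_invar_polar]
    conv_lhs => rw [← S.pr_sum (C.dia a α), ← S.pr_sum (C.dia a β)]
    simp only [map_add, LinearMap.add_apply]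
    rw [o12 _ (S.pr₁_mem _) β hβ, o21 α hα _ (S.pr₁_mem _), zero_add, zero_add]
end

section
/- Let E be a Courant algebroid over A (algebraic form) with an orthogonal splitting E = E₁ ⊕ E₂, set ∇←_β a := pr₁(β⋄a), and define Ω(a,b) := (1/2)·pr₂(a⋄b − b⋄a) for a, b ∈ E₁. Then for all a, b ∈ E₁: (i) a⋄b = pr₁(a⋄b) + (1/2)·pr₂(D⟨a,b⟩) + Ω(a,b); and (ii) Ω is determined by ∇← through the relation ⟨γ, Ω(a,b)⟩ = (1/2)(⟨∇←_γ a, b⟩ − ⟨a, ∇←_γ b⟩) for all γ ∈ E₂. -/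
section Helpers

variable {A : Type*} [CommRing A] [Algebra ℝ A]
    {E : Type*} [AddCommGroup E] [Module ℝ E] [Module A E] [IsScalarTower ℝ A E]

theorem two_cancel {V : Type*} [AddCommGroup V] [Module ℝ V] {x y : V}
    (h : x + x = y + y) : x = y := by
  have h2 : (2 : ℝ) • x = (2 : ℝ) • y := by rw [two_smul, two_smul, h]
  have := congrArg (fun z => (2⁻¹ : ℝ) • z) h2
  simpa [smul_smul] using this

theorem dia_add_dia (C : CourantAlgebroid A E) (x y : E) :
    C.dia x y + C.dia y x = C.Dop (C.ip x y) := by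
  have h := C.sym_part (x + y)
  have hx := C.sym_part x
  have hy := C.sym_part y
  simp only [map_add, LinearMap.add_apply, smul_add, C.ip_symm y x, hx, hy] at h
  have h3 : (2⁻¹ : ℝ) • C.Dop (C.ip x y) + (2⁻¹ : ℝ) • C.Dop (C.ip x y)
      = C.Dop (C.ip x y) := by
    rw [← add_smul]; norm_num
  rw [← h3]
  generalize (2⁻¹ : ℝ) • C.Dop (C.ip x y) = u at *
  generalize (2⁻¹ : ℝ) • C.Dop (C.ip x x) = v at *
  generalize (2⁻¹ : ℝ) • C.Dop (C.ip y y) = w at *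
  have h4 : (C.dia x y + C.dia y x) + (v + w) = (u + u) + (v + w) := by
    refine Eq.trans ?_ (h.trans ?_) <;> abel
  exact add_right_cancel h4

theorem anchor_ip (C : CourantAlgebroid A E) (φ x y : E) :
    C.anchor φ (C.ip x y) = C.ip (C.dia φ x) y + C.ip x (C.dia φ y) := by
  have h := C.ad_invar φ (x + y)
  have hx := C.ad_invar φ x
  have hy := C.ad_invar φ y
  simp only [map_add, LinearMap.add_apply, C.ip_symm y x, hx, hy] at h
  apply two_cancel
  rw [C.ip_symm x (C.dia φ y)]
  linear_combination h

theorem ip_dia (C : CourantAlgebroid A E) (S : OrthSplitting C) {a b γ : E}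
    (ha : a ∈ S.E₁) (hb : b ∈ S.E₁) (hγ : γ ∈ S.E₂) :
    C.ip γ (C.dia a b) = C.ip (C.dia γ a) b := by
  have h := anchor_ip C a γ b
  rw [(S.mem_E₁_iff b).1 hb γ hγ, map_zero] at h
  have h2 := congrArg (fun z => C.ip z b) (dia_add_dia C a γ)
  simp only [(S.mem_E₂_iff γ).1 hγ a ha, map_zero, map_add, LinearMap.add_apply,
    LinearMap.zero_apply] at h2
  linear_combination -h2 - h

theorem ip_pr₂ (C : CourantAlgebroid A E) (S : OrthSplitting C) {γ : E}
    (hγ : γ ∈ S.E₂) (x : E) : C.ip γ (S.pr₂ x) = C.ip γ x := by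
  conv_rhs => rw [← S.pr_sum x]
  rw [map_add, (S.mem_E₁_iff _).1 (S.pr₁_mem x) γ hγ, zero_add]

theorem ip_pr₁ (C : CourantAlgebroid A E) (S : OrthSplitting C) {a : E}
    (ha : a ∈ S.E₁) (x : E) : C.ip a (S.pr₁ x) = C.ip a x := by
  conv_rhs => rw [← S.pr_sum x]
  rw [map_add, (S.mem_E₂_iff _).1 (S.pr₂_mem x) a ha, add_zero]

end Helpers

/-- For `a, b ∈ E₁`, with `Ω(a,b) := (1/2)·pr₂(a⋄b − b⋄a)`:
(i) `a⋄b = pr₁(a⋄b) + (1/2)·pr₂(D⟨a,b⟩) + Ω(a,b)`, and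
(ii) `⟨γ, Ω(a,b)⟩ = (1/2)(⟨∇←_γ a, b⟩ − ⟨a, ∇←_γ b⟩)` for all `γ ∈ E₂`,
where `∇←_γ a := pr₁(γ⋄a)`. -/
theorem bracket_E₁_decomposition_and_Omega
    {A : Type*} [CommRing A] [Algebra ℝ A]
    {E : Type*} [AddCommGroup E] [Module ℝ E] [Module A E] [IsScalarTower ℝ A E]
    (C : CourantAlgebroid A E) (S : OrthSplitting C) :
    ∀ (a b : E), a ∈ S.E₁ → b ∈ S.E₁ →
      (C.dia a b
        = S.pr₁ (C.dia a b) + (2⁻¹ : ℝ) • S.pr₂ (C.Dop (C.ip a b))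
          + (2⁻¹ : ℝ) • S.pr₂ (C.dia a b - C.dia b a)) ∧
      (∀ γ ∈ S.E₂,
        C.ip γ ((2⁻¹ : ℝ) • S.pr₂ (C.dia a b - C.dia b a))
          = (2⁻¹ : ℝ) • (C.ip (S.pr₁ (C.dia γ a)) b - C.ip a (S.pr₁ (C.dia γ b)))) := by
  intro a b ha hb
  refine ⟨?_, ?_⟩
  · rw [← dia_add_dia C a b, add_assoc, ← smul_add, ← map_add]
    have e : C.dia a b + C.dia b a + (C.dia a b - C.dia b a)
        = C.dia a b + C.dia a b := by abel
    rw [e, map_add, smul_add, ← add_smul]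
    norm_num
    exact (S.pr_sum _).symm
  · intro γ hγ
    rw [LinearMap.map_smul_of_tower, ip_pr₂ C S hγ, map_sub, ip_dia C S ha hb hγ,
      ip_dia C S hb ha hγ, C.ip_symm (S.pr₁ _) b, ip_pr₁ C S hb, ip_pr₁ C S ha,
      C.ip_symm b, C.ip_symm a]
end

section
/- Let E be a Courant algebroid over A (algebraic form) with an orthogonal splitting E = E₁ ⊕ E₂. With the notations ∇→_a β := pr₂(a⋄β), ∇←_β a := pr₁(β⋄a), a⋄₁b := pr₁(a⋄b), α⋄₂β := pr₂(α⋄β), Ω(a,b) := (1/2)·pr₂(a⋄b − b⋄a), ℧(α,β) := (1/2)·pr₁(α⋄β − β⋄α), D₁ := pr₁∘D, D₂ := pr₂∘D, the Dorfman bracket of E is fully recovered by the formula: for all a, b ∈ E₁ and α, β ∈ E₂, (a+α)⋄(b+β) = (a⋄₁b + ∇←_α b − ∇←_β a + ℧(α,β) + (1/2)·D₁⟨α,β⟩) + (α⋄₂β + ∇→_a β − ∇→_b α + Ω(a,b) + (1/2)·D₂⟨a,b⟩). -/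
/-- The full Dorfman bracket of `E` is recovered from the component structures:
for `a, b ∈ E₁` and `α, β ∈ E₂`,
`(a+α)⋄(b+β) = (a⋄₁b + ∇←_α b − ∇←_β a + ℧(α,β) + ½·D₁⟨α,β⟩)
             + (α⋄₂β + ∇→_a β − ∇→_b α + Ω(a,b) + ½·D₂⟨a,b⟩)`,
where `a⋄₁b := pr₁(a⋄b)`, `α⋄₂β := pr₂(α⋄β)`, `∇←_α b := pr₁(α⋄b)`,
`∇→_a β := pr₂(a⋄β)`, `Ω(a,b) := ½·pr₂(a⋄b − b⋄a)`, `℧(α,β) := ½·pr₁(α⋄β − β⋄α)`,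
`D₁ := pr₁∘D`, `D₂ := pr₂∘D`. -/
theorem full_bracket_formula
    {A : Type*} [CommRing A] [Algebra ℝ A]
    {E : Type*} [AddCommGroup E] [Module ℝ E] [Module A E] [IsScalarTower ℝ A E]
    (C : CourantAlgebroid A E) (S : OrthSplitting C) :
    ∀ (a b α β : E), a ∈ S.E₁ → b ∈ S.E₁ → α ∈ S.E₂ → β ∈ S.E₂ →
      C.dia (a + α) (b + β)
        = (S.pr₁ (C.dia a b) + S.pr₁ (C.dia α b) - S.pr₁ (C.dia β a)
            + (2⁻¹ : ℝ) • S.pr₁ (C.dia α β - C.dia β α)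
            + (2⁻¹ : ℝ) • S.pr₁ (C.Dop (C.ip α β)))
          + (S.pr₂ (C.dia α β) + S.pr₂ (C.dia a β) - S.pr₂ (C.dia b α)
            + (2⁻¹ : ℝ) • S.pr₂ (C.dia a b - C.dia b a)
            + (2⁻¹ : ℝ) • S.pr₂ (C.Dop (C.ip a b))) := by
  intro a b α β ha hb hα hβ
  have pol : ∀ x y : E, C.Dop (C.ip x y) = C.dia x y + C.dia y x := by
    intro x y
    have h := C.sym_part (x + y)
    have hx := C.sym_part x
    have hy := C.sym_part y
    simp only [map_add, LinearMap.add_apply, smul_add] at h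
    rw [C.ip_symm y x, ← hx, ← hy] at h
    have h2 : C.dia x y + C.dia y x
        = (2⁻¹ : ℝ) • C.Dop (C.ip x y) + (2⁻¹ : ℝ) • C.Dop (C.ip x y) := by
      have h3 := sub_eq_zero.mpr h
      rw [← sub_eq_zero, ← h3]
      abel
    rw [h2]
    module
  have anti : ∀ x y : E, x ∈ S.E₁ → y ∈ S.E₂ → C.dia y x = - C.dia x y := by
    intro x y hx hy
    have h := pol x y
    rw [(S.mem_E₂_iff y).1 hy x hx, map_zero] at h
    exact eq_neg_of_add_eq_zero_right h.symm
  have e1 := S.pr_sum (C.dia a b)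
  have e2 := S.pr_sum (C.dia a β)
  have e3 := S.pr_sum (C.dia b α)
  have e4 := S.pr_sum (C.dia α β)
  rw [pol α β, pol a b, anti a β ha hβ, anti b α hb hα]
  simp only [map_add, map_sub, map_neg, LinearMap.add_apply]
  rw [anti b α hb hα]
  linear_combination (norm := module) (-1 : ℝ) • e1 + (-1 : ℝ) • e2 + (1 : ℝ) • e3 + (-1 : ℝ) • e4
end

section
/- In the matched-pair setup (two Courant algebroids E₁, E₂ over A with compatible connections ∇→, ∇← and maps Ω, ℧, and the candidate structure on E := E₁ × E₂ defined below), the candidate structure satisfies: ⟨D f, (b,β)⟩ = ρ(b,β)(f) for all f ∈ A; the Leibniz rule (C2): (a,α)⋄(f·(b,β)) = (ρ(a,α)f)·(b,β) + f·((a,α)⋄(b,β)); the symmetric-part axiom (C3): (a,α)⋄(a,α) = (1/2)·D⟨(a,α),(a,α)⟩; and the invariance axiom (C4): ρ(a,α)⟨(b,β),(b,β)⟩ = 2⟨(a,α)⋄(b,β),(b,β)⟩. -/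
/-- Matched-pair setup: two Courant algebroids `E₁`, `E₂` over the same `A`,
with ℝ-bilinear connections `∇→ = cr : E₁ × E₂ → E₂` and `∇← = cl : E₂ × E₁ → E₁`
satisfying the connection rules, metric invariance, `∇→_{D₁f} = 0 = ∇←_{D₂f}`,
and maps `Ω = Om : E₁ × E₁ → E₂`, `℧ = Mho : E₂ × E₂ → E₁` determined by the
connections. -/
structure MatchedPairData (A : Type*) [CommRing A] [Algebra ℝ A]
    (E₁ : Type*) [AddCommGroup E₁] [Module ℝ E₁] [Module A E₁] [IsScalarTower ℝ A E₁]
    (E₂ : Type*) [AddCommGroup E₂] [Module ℝ E₂] [Module A E₂] [IsScalarTower ℝ A E₂] where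
  C₁ : CourantAlgebroid A E₁
  C₂ : CourantAlgebroid A E₂
  cr : E₁ →ₗ[ℝ] E₂ →ₗ[ℝ] E₂
  cl : E₂ →ₗ[ℝ] E₁ →ₗ[ℝ] E₁
  cr_smul_left : ∀ (f : A) (a : E₁) (β : E₂), cr (f • a) β = f • cr a β
  cr_leibniz : ∀ (a : E₁) (f : A) (β : E₂),
    cr a (f • β) = (C₁.anchor a f) • β + f • cr a β
  cl_smul_left : ∀ (f : A) (α : E₂) (b : E₁), cl (f • α) b = f • cl α b
  cl_leibniz : ∀ (α : E₂) (f : A) (b : E₁),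
    cl α (f • b) = (C₂.anchor α f) • b + f • cl α b
  cl_metric : ∀ (α : E₂) (a b : E₁),
    C₂.anchor α (C₁.ip a b) = C₁.ip (cl α a) b + C₁.ip a (cl α b)
  cr_metric : ∀ (a : E₁) (α β : E₂),
    C₁.anchor a (C₂.ip α β) = C₂.ip (cr a α) β + C₂.ip α (cr a β)
  cr_Dop : ∀ (f : A) (β : E₂), cr (C₁.Dop f) β = 0
  cl_Dop : ∀ (f : A) (b : E₁), cl (C₂.Dop f) b = 0
  Om : E₁ → E₁ → E₂
  Mho : E₂ → E₂ → E₁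
  Om_rel : ∀ (a b : E₁) (γ : E₂),
    C₂.ip γ (Om a b) = (2⁻¹ : ℝ) • (C₁.ip (cl γ a) b - C₁.ip a (cl γ b))
  Mho_rel : ∀ (α β : E₂) (c : E₁),
    C₁.ip c (Mho α β) = (2⁻¹ : ℝ) • (C₂.ip (cr c α) β - C₂.ip α (cr c β))

section MatchedSum

variable {A : Type*} [CommRing A] [Algebra ℝ A]
  {E₁ : Type*} [AddCommGroup E₁] [Module ℝ E₁] [Module A E₁] [IsScalarTower ℝ A E₁]
  {E₂ : Type*} [AddCommGroup E₂] [Module ℝ E₂] [Module A E₂] [IsScalarTower ℝ A E₂]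

/-- Candidate inner product on `E := E₁ × E₂`. -/
def mip (M : MatchedPairData A E₁ E₂) (x y : E₁ × E₂) : A :=
  M.C₁.ip x.1 y.1 + M.C₂.ip x.2 y.2

/-- Candidate anchor on `E := E₁ × E₂`. -/
def mrho (M : MatchedPairData A E₁ E₂) (x : E₁ × E₂) : Derivation ℝ A A :=
  M.C₁.anchor x.1 + M.C₂.anchor x.2

/-- Candidate map `D` on `E := E₁ × E₂`. -/
def mD (M : MatchedPairData A E₁ E₂) (f : A) : E₁ × E₂ :=
  (M.C₁.Dop f, M.C₂.Dop f)

/-- Candidate Dorfman bracket on `E := E₁ × E₂`. -/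
noncomputable def mdia (M : MatchedPairData A E₁ E₂) (x y : E₁ × E₂) : E₁ × E₂ :=
  (M.C₁.dia x.1 y.1 + M.cl x.2 y.1 - M.cl y.2 x.1 + M.Mho x.2 y.2
      + (2⁻¹ : ℝ) • M.C₁.Dop (M.C₂.ip x.2 y.2),
   M.C₂.dia x.2 y.2 + M.cr x.1 y.2 - M.cr y.1 x.2 + M.Om x.1 y.1
      + (2⁻¹ : ℝ) • M.C₂.Dop (M.C₁.ip x.1 y.1))

end MatchedSum


section Helpers

variable {A : Type*} [CommRing A] [Algebra ℝ A]
  {E₁ : Type*} [AddCommGroup E₁] [Module ℝ E₁] [Module A E₁] [IsScalarTower ℝ A E₁]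
  {E₂ : Type*} [AddCommGroup E₂] [Module ℝ E₂] [Module A E₂] [IsScalarTower ℝ A E₂]

theorem rsmul_eq (r : ℝ) (e : E₁) : r • e = (algebraMap ℝ A r) • e :=
  (algebraMap_smul A r e).symm

theorem half_two : 2 * (algebraMap ℝ A 2⁻¹) = 1 := by
  rw [← map_ofNat (algebraMap ℝ A) 2, ← map_mul]
  norm_num

theorem CourantAlgebroid.ext_ip (C : CourantAlgebroid A E₁) {x y : E₁}
    (h : ∀ c, C.ip c x = C.ip c y) : x = y := by
  rw [← sub_eq_zero]
  apply C.ip_nondeg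
  intro c
  rw [C.ip_symm, map_sub, h, sub_self]

theorem CourantAlgebroid.ip_Dop' (C : CourantAlgebroid A E₁) (f : A) (c : E₁) :
    C.ip c (C.Dop f) = C.anchor c f := by
  rw [C.ip_symm, C.ip_Dop]

theorem Mho_self (M : MatchedPairData A E₁ E₂) (α : E₂) : M.Mho α α = 0 := by
  apply M.C₁.ext_ip
  intro c
  rw [M.Mho_rel, M.C₂.ip_symm, sub_self, smul_zero, map_zero]

theorem Om_self (M : MatchedPairData A E₁ E₂) (a : E₁) : M.Om a a = 0 := by
  apply M.C₂.ext_ip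
  intro c
  rw [M.Om_rel, M.C₁.ip_symm, sub_self, smul_zero, map_zero]

theorem Mho_leib (M : MatchedPairData A E₁ E₂) (α β : E₂) (f : A) :
    M.Mho α (f • β) + (2⁻¹ : ℝ) • M.C₁.Dop (M.C₂.ip α (f • β)) =
      f • (M.Mho α β + (2⁻¹ : ℝ) • M.C₁.Dop (M.C₂.ip α β)) := by
  apply M.C₁.ext_ip
  intro c
  simp only [map_add, map_smul, rsmul_eq (A := A), M.Mho_rel, M.cr_leibniz,
    M.C₁.ip_Dop', smul_eq_mul, Derivation.leibniz]
  ring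

theorem Om_leib (M : MatchedPairData A E₁ E₂) (a b : E₁) (f : A) :
    M.Om a (f • b) + (2⁻¹ : ℝ) • M.C₂.Dop (M.C₁.ip a (f • b)) =
      f • (M.Om a b + (2⁻¹ : ℝ) • M.C₂.Dop (M.C₁.ip a b)) := by
  apply M.C₂.ext_ip
  intro c
  simp only [map_add, map_smul, rsmul_eq (A := A), M.Om_rel, M.cl_leibniz,
    M.C₂.ip_Dop', smul_eq_mul, Derivation.leibniz]
  ring

end Helpers

/-- In the matched-pair setup, the candidate structure on `E := E₁ × E₂` satisfies
the defining relation for `D` and the Courant axioms (C2), (C3), (C4). -/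
theorem matched_sum_satisfies_C2_C3_C4
    {A : Type*} [CommRing A] [Algebra ℝ A]
    {E₁ : Type*} [AddCommGroup E₁] [Module ℝ E₁] [Module A E₁] [IsScalarTower ℝ A E₁]
    {E₂ : Type*} [AddCommGroup E₂] [Module ℝ E₂] [Module A E₂] [IsScalarTower ℝ A E₂]
    (M : MatchedPairData A E₁ E₂) :
    (∀ (f : A) (x : E₁ × E₂), mip M (mD M f) x = mrho M x f) ∧
    (∀ (x y : E₁ × E₂) (f : A),
      mdia M x (f • y) = (mrho M x f) • y + f • mdia M x y) ∧
    (∀ x : E₁ × E₂, mdia M x x = (2⁻¹ : ℝ) • mD M (mip M x x)) ∧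
    (∀ x y : E₁ × E₂, mrho M x (mip M y y) = 2 * mip M (mdia M x y) y) := by
  refine ⟨?_, ?_, ?_, ?_⟩
  · intro f x
    simp [mip, mD, mrho, M.C₁.ip_Dop, M.C₂.ip_Dop]
  · rintro ⟨a, α⟩ ⟨b, β⟩ f
    have h1 := Mho_leib M α β f
    have h2 := Om_leib M a b f
    ext
    · simp only [mdia, mrho, Prod.smul_mk, Prod.mk_add_mk, add_assoc, h1, M.C₁.leibniz,
        M.cl_leibniz, M.cl_smul_left, Derivation.add_apply]
      module
    · simp only [mdia, mrho, Prod.smul_mk, Prod.mk_add_mk, add_assoc, h2, M.C₂.leibniz,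
        M.cr_leibniz, M.cr_smul_left, Derivation.add_apply]
      module
  · rintro ⟨a, α⟩
    ext
    · simp only [mdia, mD, mip, Mho_self, M.C₁.sym_part, map_add, Prod.smul_mk]
      module
    · simp only [mdia, mD, mip, Om_self, M.C₂.sym_part, map_add, Prod.smul_mk]
      module
  · rintro ⟨a, α⟩ ⟨b, β⟩
    have hh := half_two (A := A)
    have e1 := M.C₁.ad_invar a b
    have e2 := M.C₂.ad_invar α β
    have e3 := M.cl_metric α b b
    have e4 := M.cr_metric a β β
    have e5 := M.Om_rel a b β
    have e6 := M.Mho_rel α β b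
    have e7 := M.cl_metric β a b
    have e8 := M.cr_metric b α β
    rw [M.C₁.ip_symm b (M.cl α b)] at e3
    rw [M.C₂.ip_symm β (M.cr a β)] at e4
    rw [M.C₂.ip_symm] at e5
    rw [M.C₁.ip_symm] at e6
    rw [rsmul_eq (A := A), smul_eq_mul] at e5 e6
    simp only [mrho, mip, mdia, map_add, map_sub, LinearMap.add_apply, LinearMap.sub_apply,
      Derivation.add_apply, rsmul_eq (A := A), map_smul, LinearMap.smul_apply, smul_eq_mul,
      M.C₁.ip_Dop, M.C₂.ip_Dop, e1, e2, e3, e4, e5, e6, e7, e8]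
    linear_combination (-2 * M.C₁.ip (M.cl β a) b - 2 * M.C₂.ip (M.cr b α) β) * hh
end

section
/- In the matched-pair setup (two Courant algebroids E₁, E₂ over A with compatible connections ∇→, ∇← and maps Ω, ℧, and the candidate structure on E := E₁ × E₂ defined below), the Jacobi identity (C1) for the bracket on E, namely φ⋄(φ₁⋄φ₂) = (φ⋄φ₁)⋄φ₂ + φ₁⋄(φ⋄φ₂) for all φ, φ₁, φ₂ ∈ E, holds if and only if all of the following five conditions hold for all a, a₁, a₂, a₃ ∈ E₁ and α, α₁, α₂, α₃, β ∈ E₂: (M1) ∇←_α(a₁⋄₁a₂) − (∇←_α a₁)⋄₁a₂ − a₁⋄₁(∇←_α a₂) − ∇←_{∇→_{a₂}α} a₁ + ∇←_{∇→_{a₁}α} a₂ = −℧(α, Ω(a₁,a₂) + (1/2)·D₂⟨a₁,a₂⟩₁) − (1/2)·D₁⟨α, Ω(a₁,a₂) + (1/2)·D₂⟨a₁,a₂⟩₁⟩₂; (M2) ∇→_a(α₁⋄₂α₂) − (∇→_a α₁)⋄₂α₂ − α₁⋄₂(∇→_a α₂) − ∇→_{∇←_{α₂}a} α₁ + ∇→_{∇←_{α₁}a}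 α₂ = −Ω(a, ℧(α₁,α₂) + (1/2)·D₁⟨α₁,α₂⟩₂) − (1/2)·D₂⟨a, ℧(α₁,α₂) + (1/2)·D₁⟨α₁,α₂⟩₂⟩₁; (M3) ⟨R→(a₁,a₂)α, β⟩₂ + ⟨R←(α,β)a₁, a₂⟩₁ = 0, where R→(a,b)γ := ∇→_a∇→_b γ − ∇→_b∇→_a γ − ∇→_{a⋄₁b} γ and R←(α,β)c := ∇←_α∇←_β c − ∇←_β∇←_α c − ∇←_{α⋄₂β} c; (M4) ∇←_{Ω(a₁,a₂)} a₃ + ∇←_{Ω(a₂,a₃)} a₁ + ∇←_{Ω(a₃,a₁)} a₂ = 0; (M5) ∇→_{℧(α₁,α₂)} α₃ + ∇→_{℧(α₂,α₃)} α₁ + ∇→_{℧(α₃,α₁)} α₂ = 0. -/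
section MatchedHelpers

variable {A : Type*} [CommRing A] [Algebra ℝ A]
  {E₁ : Type*} [AddCommGroup E₁] [Module ℝ E₁] [Module A E₁] [IsScalarTower ℝ A E₁]
  {E₂ : Type*} [AddCommGroup E₂] [Module ℝ E₂] [Module A E₂] [IsScalarTower ℝ A E₂]

namespace CourantAlgebroid

theorem ext_ip_s11 (C : CourantAlgebroid A E₁) {x y : E₁} (h : ∀ z, C.ip z x = C.ip z y) :
    x = y := by
  rw [← sub_eq_zero]
  apply C.ip_nondeg
  intro z
  rw [C.ip_symm, map_sub, h, sub_self]

theorem ip_rsmul (C : CourantAlgebroid A E₁) (r : ℝ) (x y : E₁) :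
    C.ip x (r • y) = r • C.ip x y := by
  rw [← algebraMap_smul A r y, map_smul, algebraMap_smul]

theorem half_cancel {V : Type*} [AddCommGroup V] [Module ℝ V] {x y : V}
    (h : x + x = y + y) : x = y := by
  have h2 : (2 : ℝ) • x = (2 : ℝ) • y := by rw [two_smul, two_smul, h]
  have h3 := congrArg (fun t => (2⁻¹ : ℝ) • t) h2
  simpa [smul_smul] using h3

theorem half_add_half {V : Type*} [AddCommGroup V] [Module ℝ V] (x : V) :
    (2⁻¹ : ℝ) • (x + x) = x := by
  rw [← two_smul ℝ x, smul_smul]; norm_num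

theorem dia_symm (C : CourantAlgebroid A E₁) (x y : E₁) :
    C.dia x y + C.dia y x = C.Dop (C.ip x y) := by
  have h := C.sym_part (x + y)
  simp only [map_add, LinearMap.add_apply, smul_add, C.sym_part x, C.sym_part y,
    C.ip_symm y x] at h
  have h2 := half_add_half (C.Dop (C.ip x y))
  rw [smul_add] at h2
  rw [← h2]
  have : C.dia x y + C.dia y x = ((2⁻¹ : ℝ) • C.Dop ((C.ip x) x) + (C.dia y) x
    + ((C.dia x) y + (2⁻¹ : ℝ) • C.Dop ((C.ip y) y)))
    - (2⁻¹ : ℝ) • C.Dop ((C.ip x) x) - (2⁻¹ : ℝ) • C.Dop ((C.ip y) y) := by abel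
  rw [this, h]
  abel

theorem ad_inv (C : CourantAlgebroid A E₁) (x y z : E₁) :
    C.anchor x (C.ip y z) = C.ip (C.dia x y) z + C.ip (C.dia x z) y := by
  have h := C.ad_invar x (y + z)
  have hy := C.ad_invar x y
  have hz := C.ad_invar x z
  simp only [map_add, LinearMap.add_apply] at h
  rw [C.ip_symm z y] at h
  apply half_cancel
  linear_combination h - hy - hz

end CourantAlgebroid

namespace MatchedPairData

/-- Exchange the roles of the two Courant algebroids. -/
def swp (M : MatchedPairData A E₁ E₂) : MatchedPairData A E₂ E₁ where
  C₁ := M.C₂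
  C₂ := M.C₁
  cr := M.cl
  cl := M.cr
  cr_smul_left := M.cl_smul_left
  cr_leibniz := M.cl_leibniz
  cl_smul_left := M.cr_smul_left
  cl_leibniz := M.cr_leibniz
  cl_metric := M.cr_metric
  cr_metric := M.cl_metric
  cr_Dop := M.cl_Dop
  cl_Dop := M.cr_Dop
  Om := M.Mho
  Mho := M.Om
  Om_rel := M.Mho_rel
  Mho_rel := M.Om_rel

/-- The combination `Ω(a,b) + (1/2) D₂⟨a,b⟩`. -/
noncomputable def Q (M : MatchedPairData A E₁ E₂) (a b : E₁) : E₂ :=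
  M.Om a b + (2⁻¹ : ℝ) • M.C₂.Dop (M.C₁.ip a b)

/-- The combination `℧(α,β) + (1/2) D₁⟨α,β⟩`. -/
noncomputable def P (M : MatchedPairData A E₁ E₂) (α β : E₂) : E₁ :=
  M.Mho α β + (2⁻¹ : ℝ) • M.C₁.Dop (M.C₂.ip α β)

theorem ip_Q (M : MatchedPairData A E₁ E₂) (γ : E₂) (a b : E₁) :
    M.C₂.ip γ (M.Q a b) = M.C₁.ip (M.cl γ a) b := by
  rw [Q, map_add, M.Om_rel, M.C₂.ip_rsmul, M.C₂.ip_symm, M.C₂.ip_Dop, M.cl_metric, ← smul_add]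
  rw [← CourantAlgebroid.half_add_half (M.C₁.ip (M.cl γ a) b)]
  congr 1
  rw [CourantAlgebroid.half_add_half]
  ring

theorem ip_P (M : MatchedPairData A E₁ E₂) (c : E₁) (α β : E₂) :
    M.C₁.ip c (M.P α β) = M.C₂.ip (M.cr c α) β := M.swp.ip_Q c α β

theorem Q_add_left (M : MatchedPairData A E₁ E₂) (a b c : E₁) :
    M.Q (a + b) c = M.Q a c + M.Q b c :=
  M.C₂.ext_ip_s11 fun γ => by simp [ip_Q]

theorem Q_add_right (M : MatchedPairData A E₁ E₂) (a b c : E₁) :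
    M.Q a (b + c) = M.Q a b + M.Q a c :=
  M.C₂.ext_ip_s11 fun γ => by simp [ip_Q]

theorem P_add_left (M : MatchedPairData A E₁ E₂) (a b c : E₂) :
    M.P (a + b) c = M.P a c + M.P b c := M.swp.Q_add_left a b c

theorem P_add_right (M : MatchedPairData A E₁ E₂) (a b c : E₂) :
    M.P a (b + c) = M.P a b + M.P a c := M.swp.Q_add_right a b c

theorem Q_symm (M : MatchedPairData A E₁ E₂) (a b : E₁) :
    M.Q a b + M.Q b a = M.C₂.Dop (M.C₁.ip a b) :=
  M.C₂.ext_ip_s11 fun γ => by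
    rw [map_add, ip_Q, ip_Q, M.C₂.ip_symm, M.C₂.ip_Dop, M.cl_metric, M.C₁.ip_symm a]

theorem P_symm (M : MatchedPairData A E₁ E₂) (a b : E₂) :
    M.P a b + M.P b a = M.C₁.Dop (M.C₂.ip a b) := M.swp.Q_symm a b

theorem cl_Q (M : MatchedPairData A E₁ E₂) (a b c : E₁) :
    M.cl (M.Q a b) c = M.cl (M.Om a b) c := by
  simp [Q, M.cl_Dop]

theorem Q_zero_left (M : MatchedPairData A E₁ E₂) (a : E₁) : M.Q 0 a = 0 := by
  simpa using M.Q_add_left 0 0 a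

theorem Q_zero_right (M : MatchedPairData A E₁ E₂) (a : E₁) : M.Q a 0 = 0 := by
  simpa using M.Q_add_right a 0 0

theorem P_zero_left (M : MatchedPairData A E₁ E₂) (a : E₂) : M.P 0 a = 0 := by
  simpa using M.P_add_left 0 0 a

theorem P_zero_right (M : MatchedPairData A E₁ E₂) (a : E₂) : M.P a 0 = 0 := by
  simpa using M.P_add_right a 0 0

theorem mdia_eq (M : MatchedPairData A E₁ E₂) (x y : E₁ × E₂) :
    mdia M x y = (M.C₁.dia x.1 y.1 + M.cl x.2 y.1 - M.cl y.2 x.1 + M.P x.2 y.2,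
      M.C₂.dia x.2 y.2 + M.cr x.1 y.2 - M.cr y.1 x.2 + M.Q x.1 y.1) := by
  simp only [mdia, P, Q, add_assoc]

theorem mdia_swp (M : MatchedPairData A E₁ E₂) (x y : E₁ × E₂) :
    mdia M.swp x.swap y.swap = (mdia M x y).swap := rfl

theorem mdia_add_left (M : MatchedPairData A E₁ E₂) (x y z : E₁ × E₂) :
    mdia M (x + y) z = mdia M x z + mdia M y z := by
  ext
  · simp only [mdia_eq, Prod.fst_add, Prod.snd_add, map_add, LinearMap.add_apply, P_add_left]
    abel
  · simp only [mdia_eq, Prod.fst_add, Prod.snd_add, map_add, LinearMap.add_apply, Q_add_left]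
    abel

theorem mdia_add_right (M : MatchedPairData A E₁ E₂) (x y z : E₁ × E₂) :
    mdia M x (y + z) = mdia M x y + mdia M x z := by
  ext
  · simp only [mdia_eq, Prod.fst_add, Prod.snd_add, map_add, LinearMap.add_apply, P_add_right]
    abel
  · simp only [mdia_eq, Prod.fst_add, Prod.snd_add, map_add, LinearMap.add_apply, Q_add_right]
    abel

theorem mdia_symm (M : MatchedPairData A E₁ E₂) (x y : E₁ × E₂) :
    mdia M x y + mdia M y x = mD M (mip M x y) := by
  ext
  · simp only [mdia_eq, mD, mip, Prod.fst_add, map_add, ← M.P_symm, ← M.C₁.dia_symm]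
    abel
  · simp only [mdia_eq, mD, mip, Prod.snd_add, map_add, ← M.Q_symm, ← M.C₂.dia_symm]
    abel

/-- The Jacobiator. -/
noncomputable def J (M : MatchedPairData A E₁ E₂) (x y z : E₁ × E₂) : E₁ × E₂ :=
  mdia M x (mdia M y z) - mdia M (mdia M x y) z - mdia M y (mdia M x z)

theorem J_swp (M : MatchedPairData A E₁ E₂) (x y z : E₁ × E₂) :
    M.swp.J x.swap y.swap z.swap = (M.J x y z).swap := rfl

theorem J_eq_zero (M : MatchedPairData A E₁ E₂) (x y z : E₁ × E₂) :
    M.J x y z = 0 ↔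
      mdia M x (mdia M y z) = mdia M (mdia M x y) z + mdia M y (mdia M x z) := by
  rw [J, sub_sub, sub_eq_zero]

theorem mdia_zero_left (M : MatchedPairData A E₁ E₂) (x : E₁ × E₂) : mdia M 0 x = 0 := by
  simpa using M.mdia_add_left 0 0 x

theorem mdia_zero_right (M : MatchedPairData A E₁ E₂) (x : E₁ × E₂) : mdia M x 0 = 0 := by
  simpa using M.mdia_add_right x 0 0

theorem J_add₁ (M : MatchedPairData A E₁ E₂) (x x' y z : E₁ × E₂) :
    M.J (x + x') y z = M.J x y z + M.J x' y z := by
  simp only [J, mdia_add_left, mdia_add_right]; abel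

theorem J_add₂ (M : MatchedPairData A E₁ E₂) (x y y' z : E₁ × E₂) :
    M.J x (y + y') z = M.J x y z + M.J x y' z := by
  simp only [J, mdia_add_left, mdia_add_right]; abel

theorem J_add₃ (M : MatchedPairData A E₁ E₂) (x y z z' : E₁ × E₂) :
    M.J x y (z + z') = M.J x y z + M.J x y z' := by
  simp only [J, mdia_add_left, mdia_add_right]; abel

/-- The (M1) defect. -/
noncomputable def m1 (M : MatchedPairData A E₁ E₂) (α : E₂) (a b : E₁) : E₁ :=
  M.cl α (M.C₁.dia a b) - M.C₁.dia (M.cl α a) b - M.C₁.dia a (M.cl α b)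
    - M.cl (M.cr b α) a + M.cl (M.cr a α) b + M.P α (M.Q a b)

/-- The (M3) defect. -/
noncomputable def m3 (M : MatchedPairData A E₁ E₂) (a b : E₁) (α β : E₂) : A :=
  M.C₂.ip (M.cr a (M.cr b α) - M.cr b (M.cr a α) - M.cr (M.C₁.dia a b) α) β
    + M.C₁.ip (M.cl α (M.cl β a) - M.cl β (M.cl α a) - M.cl (M.C₂.dia α β) a) b

/-- The (M4) defect. -/
noncomputable def m4 (M : MatchedPairData A E₁ E₂) (a b c : E₁) : E₁ :=
  M.cl (M.Om a b) c + M.cl (M.Om b c) a + M.cl (M.Om c a) b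

theorem J_211_fst (M : MatchedPairData A E₁ E₂) (α : E₂) (a b : E₁) :
    (M.J (0, α) (a, 0) (b, 0)).1 = M.m1 α a b := by
  simp only [J, mdia_eq, m1, map_zero, LinearMap.zero_apply, P_zero_left, P_zero_right, Q_zero_left, Q_zero_right,
    Prod.fst_sub, add_zero, zero_add, sub_zero, zero_sub, map_neg, LinearMap.neg_apply]
  abel

theorem J_211_snd (M : MatchedPairData A E₁ E₂) (α β : E₂) (a b : E₁) :
    M.C₂.ip (M.J (0, α) (a, 0) (b, 0)).2 β = M.m3 a b α β := by
  have h1 := M.C₂.ad_inv α (M.Q a b) β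
  rw [M.C₂.ip_symm (M.Q a b) β, ip_Q, M.cl_metric, M.C₂.ip_symm (M.C₂.dia α β), 
    M.C₂.ip_symm (M.Q a b), ip_Q] at h1
  have h2 := M.ip_Q β (M.cl α a) b
  have h3 := M.ip_Q β a (M.cl α b)
  rw [M.C₂.ip_symm] at h2 h3
  simp only [J, mdia_eq, m3, map_zero, LinearMap.zero_apply, P_zero_left, P_zero_right, Q_zero_left, Q_zero_right,
    Prod.snd_sub, add_zero, zero_add, sub_zero, zero_sub, map_neg, LinearMap.neg_apply,
    map_add, map_sub, LinearMap.add_apply, LinearMap.sub_apply]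
  linear_combination -h1 - h2 - h3

theorem J_111_fst (M : MatchedPairData A E₁ E₂) (a b c : E₁) :
    (M.J (a, 0) (b, 0) (c, 0)).1 = - M.m4 a b c := by
  have h : M.cl (M.Om c a) b = - M.cl (M.Q a c) b := by
    rw [← cl_Q, eq_neg_iff_add_eq_zero, ← LinearMap.add_apply, ← map_add, M.Q_symm, M.cl_Dop]
  simp only [J, mdia_eq, m4, map_zero, LinearMap.zero_apply, P_zero_left, P_zero_right, Q_zero_left, Q_zero_right,
    Prod.fst_sub, add_zero, zero_add, sub_zero, zero_sub, h, ← cl_Q, M.C₁.jacobi a b c]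
  abel

theorem J_111_snd (M : MatchedPairData A E₁ E₂) (a b c : E₁) (α : E₂) :
    M.C₂.ip α (M.J (a, 0) (b, 0) (c, 0)).2 = - M.C₁.ip (M.m1 α a b) c := by
  have metr : ∀ x y z : E₁, M.C₂.ip α (M.cr x (M.Q y z))
      = M.C₁.anchor x (M.C₁.ip (M.cl α y) z) - M.C₁.ip (M.cl (M.cr x α) y) z := by
    intro x y z
    have h := M.cr_metric x α (M.Q y z)
    rw [ip_Q, ip_Q] at h
    rw [h]; ring
  have h1 := M.C₁.ad_inv a (M.cl α b) c
  have h2 := M.C₁.ad_inv b (M.cl α a) c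
  have h3 := congrArg (fun t => M.C₁.ip t c) (M.C₁.dia_symm (M.cl α a) b)
  simp only [map_add, LinearMap.add_apply, M.C₁.ip_Dop] at h3
  have h4 := M.ip_P c α (M.Q a b)
  rw [ip_Q, M.C₁.ip_symm] at h4
  have h5 := M.C₁.ip_symm (M.C₁.dia a c) (M.cl α b)
  have h6 := M.C₁.ip_symm (M.C₁.dia b c) (M.cl α a)
  simp only [J, mdia_eq, m1, map_zero, LinearMap.zero_apply, P_zero_left, P_zero_right, Q_zero_left, Q_zero_right,
    Prod.snd_sub, add_zero, zero_add, sub_zero, zero_sub, map_neg, LinearMap.neg_apply,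
    map_add, map_sub, LinearMap.add_apply, LinearMap.sub_apply, ip_Q, metr]
  linear_combination h1 - h2 - h3 + h4 + h5 - h6

theorem J_121 (M : MatchedPairData A E₁ E₂) (α : E₂) (a b : E₁) :
    M.J (a, 0) (0, α) (b, 0) = - M.J (0, α) (a, 0) (b, 0) := by
  have h : mdia M (a, 0) (0, α) + mdia M (0, α) (a, 0) = 0 := by
    simp [mdia_symm, mip, mD]
  have h2 := M.mdia_add_left (mdia M (a, 0) (0, α)) (mdia M (0, α) (a, 0)) (b, 0)
  rw [h, mdia_zero_left] at h2
  rw [eq_neg_iff_add_eq_zero]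
  simp only [J]
  rw [← neg_eq_zero, h2]
  abel

theorem J_112 (M : MatchedPairData A E₁ E₂) (α : E₂) (a b : E₁) :
    M.J (a, 0) (b, 0) (0, α) = - M.J (a, 0) (0, α) (b, 0) := by
  have h : mdia M (b, 0) (0, α) + mdia M (0, α) (b, 0) = 0 := by
    simp [mdia_symm, mip, mD]
  have h2 := M.mdia_add_right (a, 0) (mdia M (b, 0) (0, α)) (mdia M (0, α) (b, 0))
  rw [h, mdia_zero_right] at h2
  have h3 := M.mdia_symm (mdia M (a, 0) (b, 0)) (0, α)
  have h4 := M.mdia_symm (b, 0) (mdia M (a, 0) (0, α))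
  have h5 : mD M (mip M (mdia M (a, 0) (b, 0)) (0, α))
      + mD M (mip M (b, 0) (mdia M (a, 0) (0, α))) = 0 := by
    have : mip M (mdia M (a, 0) (b, 0)) (0, α)
      = - mip M (b, 0) (mdia M (a, 0) (0, α)) := by
      simp [mip, mdia_eq, P_zero_left, Q_zero_right, M.C₂.ip_symm _ α, ip_Q,
        M.C₁.ip_symm b]
    rw [this]
    simp [mD]
  rw [← h3, ← h4] at h5
  rw [eq_neg_iff_add_eq_zero]
  simp only [J]
  rw [← sub_self (0 : E₁ × E₂)]
  nth_rewrite 1 [h2]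
  rw [← h5]
  abel

/-- All Jacobiators with at least two entries in `E₁` vanish. -/
theorem J_half (M : MatchedPairData A E₁ E₂) (h1 : ∀ α a b, M.m1 α a b = 0)
    (h3 : ∀ a b α β, M.m3 a b α β = 0) (h4 : ∀ a b c, M.m4 a b c = 0) :
    (∀ a b c, M.J (a, 0) (b, 0) (c, 0) = 0) ∧ (∀ α a b, M.J (0, α) (a, 0) (b, 0) = 0) ∧
    (∀ α a b, M.J (a, 0) (0, α) (b, 0) = 0) ∧ (∀ α a b, M.J (a, 0) (b, 0) (0, α) = 0) := by
  have k : ∀ α a b, M.J (0, α) (a, 0) (b, 0) = 0 := by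
    intro α a b
    ext
    · rw [J_211_fst, h1]; rfl
    · apply M.C₂.ip_nondeg
      intro β
      rw [J_211_snd, h3]
  have k2 : ∀ α a b, M.J (a, 0) (0, α) (b, 0) = 0 := by
    intro α a b
    rw [J_121, k, neg_zero]
  refine ⟨?_, k, k2, ?_⟩
  · intro a b c
    ext
    · rw [J_111_fst, h4, neg_zero]; rfl
    · apply M.C₂.ext_ip_s11
      intro β
      rw [J_111_snd, h1]
      simp
  · intro α a b
    rw [J_112, k2, neg_zero]

theorem m3_swp (M : MatchedPairData A E₁ E₂) (a b : E₁) (α β : E₂)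
    (h : ∀ a b α β, M.m3 a b α β = 0) : M.swp.m3 α β a b = 0 := by
  have := h a b α β
  unfold m3 at this ⊢
  rw [add_comm]
  exact this

theorem m1_iff (M : MatchedPairData A E₁ E₂) (α : E₂) (a₁ a₂ : E₁) :
    (M.cl α (M.C₁.dia a₁ a₂) - M.C₁.dia (M.cl α a₁) a₂ - M.C₁.dia a₁ (M.cl α a₂)
            - M.cl (M.cr a₂ α) a₁ + M.cl (M.cr a₁ α) a₂
          = - M.Mho α (M.Om a₁ a₂ + (2⁻¹ : ℝ) • M.C₂.Dop (M.C₁.ip a₁ a₂))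
            - (2⁻¹ : ℝ) • M.C₁.Dop
                (M.C₂.ip α (M.Om a₁ a₂ + (2⁻¹ : ℝ) • M.C₂.Dop (M.C₁.ip a₁ a₂))))
    ↔ M.m1 α a₁ a₂ = 0 := by
  rw [m1, ← eq_neg_iff_add_eq_zero, P, neg_add, ← sub_eq_add_neg]
  rfl

theorem jacobi_iff (M : MatchedPairData A E₁ E₂) :
    (∀ x y z, M.J x y z = 0) ↔
      ((∀ α a b, M.m1 α a b = 0) ∧ (∀ a α β, M.swp.m1 a α β = 0) ∧
       (∀ a b α β, M.m3 a b α β = 0) ∧ (∀ a b c, M.m4 a b c = 0) ∧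
       (∀ α β γ, M.swp.m4 α β γ = 0)) := by
  constructor
  · intro h
    have h' : ∀ x y z, M.swp.J x y z = 0 := by
      intro x y z
      have := M.J_swp x.swap y.swap z.swap
      rw [h] at this
      exact this
    refine ⟨?_, ?_, ?_, ?_, ?_⟩
    · intro α a b; rw [← J_211_fst, h]; rfl
    · intro α a b; rw [← J_211_fst, h']; rfl
    · intro a b α β; rw [← J_211_snd, h]; simp
    · intro a b c; rw [← neg_eq_zero, ← J_111_fst, h]; rfl
    · intro a b c; rw [← neg_eq_zero, ← J_111_fst, h']; rfl
  · rintro ⟨h1, h2, h3, h4, h5⟩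
    obtain ⟨k1, k2, k3, k4⟩ := M.J_half h1 h3 h4
    obtain ⟨l1, l2, l3, l4⟩ := M.swp.J_half h2 (fun α β a b => M.m3_swp a b α β h3) h5
    have sw : ∀ x y z : E₁ × E₂, M.swp.J x.swap y.swap z.swap = 0 → M.J x y z = 0 := by
      intro x y z h
      rw [J_swp] at h
      exact congrArg Prod.swap h
    rintro ⟨a, α⟩ ⟨b, β⟩ ⟨c, γ⟩
    have e1 : ((a, α) : E₁ × E₂) = (a, 0) + (0, α) := by simp
    have e2 : ((b, β) : E₁ × E₂) = (b, 0) + (0, β) := by simp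
    have e3 : ((c, γ) : E₁ × E₂) = (c, 0) + (0, γ) := by simp
    rw [e1, e2, e3]
    simp only [J_add₁, J_add₂, J_add₃, k1, k2, k3, k4]
    rw [sw (0, α) (0, β) (0, γ) (l1 _ _ _), sw (a, 0) (0, β) (0, γ) (l2 _ _ _),
      sw (0, α) (b, 0) (0, γ) (l3 _ _ _), sw (0, α) (0, β) (c, 0) (l4 _ _ _)]
    simp

end MatchedPairData

end MatchedHelpers

/-- In the matched-pair setup, the Jacobi identity (C1) for the candidate bracket on
`E := E₁ × E₂` holds if and only if the five matching conditions (M1)–(M5) hold. -/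
theorem matched_sum_jacobi_iff
    {A : Type*} [CommRing A] [Algebra ℝ A]
    {E₁ : Type*} [AddCommGroup E₁] [Module ℝ E₁] [Module A E₁] [IsScalarTower ℝ A E₁]
    {E₂ : Type*} [AddCommGroup E₂] [Module ℝ E₂] [Module A E₂] [IsScalarTower ℝ A E₂]
    (M : MatchedPairData A E₁ E₂) :
    (∀ x y z : E₁ × E₂,
        mdia M x (mdia M y z) = mdia M (mdia M x y) z + mdia M y (mdia M x z))
    ↔
    ((∀ (α : E₂) (a₁ a₂ : E₁),
        M.cl α (M.C₁.dia a₁ a₂) - M.C₁.dia (M.cl α a₁) a₂ - M.C₁.dia a₁ (M.cl α a₂)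
            - M.cl (M.cr a₂ α) a₁ + M.cl (M.cr a₁ α) a₂
          = - M.Mho α (M.Om a₁ a₂ + (2⁻¹ : ℝ) • M.C₂.Dop (M.C₁.ip a₁ a₂))
            - (2⁻¹ : ℝ) • M.C₁.Dop
                (M.C₂.ip α (M.Om a₁ a₂ + (2⁻¹ : ℝ) • M.C₂.Dop (M.C₁.ip a₁ a₂)))) ∧
     (∀ (a : E₁) (α₁ α₂ : E₂),
        M.cr a (M.C₂.dia α₁ α₂) - M.C₂.dia (M.cr a α₁) α₂ - M.C₂.dia α₁ (M.cr a α₂)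
            - M.cr (M.cl α₂ a) α₁ + M.cr (M.cl α₁ a) α₂
          = - M.Om a (M.Mho α₁ α₂ + (2⁻¹ : ℝ) • M.C₁.Dop (M.C₂.ip α₁ α₂))
            - (2⁻¹ : ℝ) • M.C₂.Dop
                (M.C₁.ip a (M.Mho α₁ α₂ + (2⁻¹ : ℝ) • M.C₁.Dop (M.C₂.ip α₁ α₂)))) ∧
     (∀ (a₁ a₂ : E₁) (α β : E₂),
        M.C₂.ip (M.cr a₁ (M.cr a₂ α) - M.cr a₂ (M.cr a₁ α)
            - M.cr (M.C₁.dia a₁ a₂) α) β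
          + M.C₁.ip (M.cl α (M.cl β a₁) - M.cl β (M.cl α a₁)
            - M.cl (M.C₂.dia α β) a₁) a₂ = 0) ∧
     (∀ a₁ a₂ a₃ : E₁,
        M.cl (M.Om a₁ a₂) a₃ + M.cl (M.Om a₂ a₃) a₁ + M.cl (M.Om a₃ a₁) a₂ = 0) ∧
     (∀ α₁ α₂ α₃ : E₂,
        M.cr (M.Mho α₁ α₂) α₃ + M.cr (M.Mho α₂ α₃) α₁ + M.cr (M.Mho α₃ α₁) α₂ = 0)) := by
  have h := M.jacobi_iff
  simp only [MatchedPairData.J_eq_zero] at h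
  rw [h]
  refine and_congr ?_ (and_congr ?_ Iff.rfl)
  · exact forall_congr' fun α => forall_congr' fun a => forall_congr' fun b =>
      (M.m1_iff α a b).symm
  · exact forall_congr' fun α => forall_congr' fun a => forall_congr' fun b =>
      (M.swp.m1_iff α a b).symm
end

section
/- (Mokri, converse) Let (L, [·,·], ρ) be a Lie algebroid over A (algebraic form), and let A₁, A₂ ⊆ L be A-submodules closed under the bracket (Lie subalgebroids) with L = A₁ ⊕ A₂ (internal direct sum, with projections pr₁, pr₂). Define ∇←_β a := −pr₁([a,β]) and ∇→_a β := pr₂([a,β]) for a ∈ A₁, β ∈ A₂. Then (∇←, ∇→) is a matched pair structure on (A₁, A₂) (with the restricted brackets and anchors): both maps satisfy the connection rules, both are flat, and the two compatibility conditions hold. -/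
/-- A Lie algebroid over a commutative ℝ-algebra `A` (algebraic form, i.e. a
Lie–Rinehart algebra): an `A`-module `L` with an ℝ-bilinear skew-symmetric bracket
satisfying the Jacobi identity, and an `A`-linear anchor into the ℝ-linear
derivations of `A` satisfying the Leibniz rule and compatible with brackets. -/
structure LieAlgebroid (A : Type*) [CommRing A] [Algebra ℝ A]
    (L : Type*) [AddCommGroup L] [Module ℝ L] [Module A L] [IsScalarTower ℝ A L] where
  br : L →ₗ[ℝ] L →ₗ[ℝ] L
  br_skew : ∀ a b : L, br a b = - br b a
  jacobi : ∀ a b c : L, br a (br b c) = br (br a b) c + br b (br a c)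
  anchor : L →ₗ[A] Derivation ℝ A A
  leibniz : ∀ (a b : L) (f : A), br a (f • b) = (anchor a f) • b + f • br a b
  anchor_br : ∀ (a b : L) (f : A),
    anchor (br a b) f = anchor a (anchor b f) - anchor b (anchor a f)

section

variable {A : Type*} [CommRing A] [Algebra ℝ A]
  {L : Type*} [AddCommGroup L] [Module ℝ L] [Module A L] [IsScalarTower ℝ A L]

/-- The connection `∇←_β a := −pr₁([a,β])` induced by a direct sum decomposition of a
Lie algebroid. -/
def clv (LA : LieAlgebroid A L) (pr₁ : L →ₗ[A] L) (β a : L) : L := - pr₁ (LA.br a β)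

/-- The connection `∇→_a β := pr₂([a,β])` induced by a direct sum decomposition of a
Lie algebroid. -/
def crv (LA : LieAlgebroid A L) (pr₂ : L →ₗ[A] L) (a β : L) : L := pr₂ (LA.br a β)

end

/-- (Mokri, converse) If a Lie algebroid `L` decomposes as an internal direct sum
`L = A₁ ⊕ A₂` of two Lie subalgebroids, then `∇←_β a := −pr₁([a,β])` and
`∇→_a β := pr₂([a,β])` form a matched pair structure on `(A₁, A₂)`: both satisfy the
connection rules, both are flat, and the two compatibility conditions hold. -/
theorem direct_sum_decomposition_gives_matched_pair
    {A : Type*} [CommRing A] [Algebra ℝ A]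
    {L : Type*} [AddCommGroup L] [Module ℝ L] [Module A L] [IsScalarTower ℝ A L]
    (LA : LieAlgebroid A L) (A₁ A₂ : Submodule A L)
    (indep : A₁ ⊓ A₂ = ⊥) (spans : A₁ ⊔ A₂ = ⊤)
    (hA₁ : ∀ a ∈ A₁, ∀ b ∈ A₁, LA.br a b ∈ A₁)
    (hA₂ : ∀ α ∈ A₂, ∀ β ∈ A₂, LA.br α β ∈ A₂)
    (pr₁ pr₂ : L →ₗ[A] L)
    (pr₁_mem : ∀ x : L, pr₁ x ∈ A₁) (pr₂_mem : ∀ x : L, pr₂ x ∈ A₂)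
    (pr_sum : ∀ x : L, pr₁ x + pr₂ x = x) :
    ∀ (f : A) (a b c : L) (α β γ : L),
      a ∈ A₁ → b ∈ A₁ → c ∈ A₁ → α ∈ A₂ → β ∈ A₂ → γ ∈ A₂ →
      (clv LA pr₁ (f • α) b = f • clv LA pr₁ α b) ∧
      (clv LA pr₁ α (f • b) = (LA.anchor α f) • b + f • clv LA pr₁ α b) ∧
      (crv LA pr₂ (f • a) β = f • crv LA pr₂ a β) ∧
      (crv LA pr₂ a (f • β) = (LA.anchor a f) • β + f • crv LA pr₂ a β) ∧
      (clv LA pr₁ α (clv LA pr₁ β c) - clv LA pr₁ β (clv LA pr₁ α c)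
        = clv LA pr₁ (LA.br α β) c) ∧
      (crv LA pr₂ a (crv LA pr₂ b γ) - crv LA pr₂ b (crv LA pr₂ a γ)
        = crv LA pr₂ (LA.br a b) γ) ∧
      (clv LA pr₁ α (LA.br b c)
        = LA.br (clv LA pr₁ α b) c + LA.br b (clv LA pr₁ α c)
          + clv LA pr₁ (crv LA pr₂ c α) b - clv LA pr₁ (crv LA pr₂ b α) c) ∧
      (crv LA pr₂ a (LA.br β γ)
        = LA.br (crv LA pr₂ a β) γ + LA.br β (crv LA pr₂ a γ)
          + crv LA pr₂ (clv LA pr₁ γ a) β - crv LA pr₂ (clv LA pr₁ β a) γ) := by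
  have p2a : ∀ x ∈ A₁, pr₂ x = 0 := by
    intro x hx
    have h1 : pr₂ x ∈ A₁ := by
      have h : pr₂ x = x - pr₁ x := eq_sub_of_add_eq' (pr_sum x)
      rw [h]
      exact A₁.sub_mem hx (pr₁_mem x)
    have h2 : pr₂ x ∈ A₁ ⊓ A₂ := ⟨h1, pr₂_mem x⟩
    rw [indep] at h2
    exact (Submodule.mem_bot A).1 h2
  have p1b : ∀ x ∈ A₂, pr₁ x = 0 := by
    intro x hx
    have h1 : pr₁ x ∈ A₂ := by
      have h : pr₁ x = x - pr₂ x := eq_sub_of_add_eq (pr_sum x)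
      rw [h]
      exact A₂.sub_mem hx (pr₂_mem x)
    have h2 : pr₁ x ∈ A₁ ⊓ A₂ := ⟨pr₁_mem x, h1⟩
    rw [indep] at h2
    exact (Submodule.mem_bot A).1 h2
  have p1a : ∀ x ∈ A₁, pr₁ x = x := by
    intro x hx
    have h := pr_sum x
    rwa [p2a x hx, add_zero] at h
  have p2b : ∀ x ∈ A₂, pr₂ x = x := by
    intro x hx
    have h := pr_sum x
    rwa [p1b x hx, zero_add] at h
  have leib : ∀ (x y : L) (f : A),
      LA.br (f • x) y = -((LA.anchor y f) • x) + f • LA.br x y := by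
    intro x y f
    rw [LA.br_skew, LA.leibniz, LA.br_skew y x, smul_neg, neg_add, neg_neg]
  have spl : ∀ x y, LA.br x y = LA.br (pr₁ x) y + LA.br (pr₂ x) y := by
    intro x y
    rw [← LinearMap.add_apply, ← map_add, pr_sum]
  have spr : ∀ x y, LA.br x y = LA.br x (pr₁ y) + LA.br x (pr₂ y) := by
    intro x y
    rw [← map_add, pr_sum]
  -- projections of brackets with one argument in a subalgebroid
  have q1 : ∀ x, ∀ y ∈ A₂, pr₁ (LA.br (pr₁ x) y) = pr₁ (LA.br x y) := by
    intro x y hy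
    rw [spl x y, map_add, p1b _ (hA₂ _ (pr₂_mem x) _ hy), add_zero]
  have q2 : ∀ x ∈ A₁, ∀ y, pr₂ (LA.br x (pr₂ y)) = pr₂ (LA.br x y) := by
    intro x hx y
    rw [spr x y, map_add, p2a _ (hA₁ _ hx _ (pr₁_mem y)), zero_add]
  have r1 : ∀ x ∈ A₁, ∀ y, pr₁ (LA.br x y) = LA.br x (pr₁ y) + pr₁ (LA.br x (pr₂ y)) := by
    intro x hx y
    rw [spr x y, map_add, p1a _ (hA₁ _ hx _ (pr₁_mem y))]
  have r2 : ∀ x ∈ A₂, ∀ y, pr₂ (LA.br x y) = LA.br x (pr₂ y) + pr₂ (LA.br x (pr₁ y)) := by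
    intro x hx y
    rw [spr x y, map_add, p2b _ (hA₂ _ hx _ (pr₂_mem y)), add_comm]
  intro f a b c α β γ ha hb hc hα hβ hγ
  unfold clv crv
  refine ⟨?_, ?_, ?_, ?_, ?_, ?_, ?_, ?_⟩
  · rw [LA.leibniz, map_add, map_smul, map_smul, p1b α hα, smul_zero, zero_add, smul_neg]
  · rw [leib, map_add, map_neg, map_smul, map_smul, p1a b hb, neg_add, neg_neg, smul_neg]
  · rw [leib, map_add, map_neg, map_smul, map_smul, p2a a ha, smul_zero, neg_zero, zero_add]
  · rw [LA.leibniz, map_add, map_smul, map_smul, p2b β hβ]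
  · simp only [map_neg, LinearMap.neg_apply, neg_neg]
    rw [q1 _ _ hα, q1 _ _ hβ, LA.jacobi c α β, LA.br_skew α, map_add, map_neg]
    abel
  · rw [q2 _ ha, q2 _ hb, LA.jacobi a b γ, map_add]
    abel
  · have h : LA.br (LA.br b c) α = LA.br b (LA.br c α) - LA.br c (LA.br b α) :=
      eq_sub_of_add_eq (LA.jacobi b c α).symm
    rw [h, map_sub, r1 b hb (LA.br c α), r1 c hc (LA.br b α), LA.br_skew (-pr₁ (LA.br b α)) c, map_neg, map_neg]
    abel
  · rw [LA.jacobi a β γ, LA.br_skew (LA.br a β) γ, map_add, map_neg, r2 γ hγ (LA.br a β), r2 β hβ (LA.br a γ),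
      LA.br_skew (pr₂ (LA.br a β)) γ, LA.br_skew (-pr₁ (LA.br a γ)) β,
      LA.br_skew (-pr₁ (LA.br a β)) γ]
    simp only [map_neg, neg_neg]
    abel
end

section
/- Let E be a Courant algebroid over A (algebraic form) with an orthogonal splitting E = E₁ ⊕ E₂, and let D₁ ⊆ E₁ and D₂ ⊆ E₂ be Dirac structures in E₁ and E₂ respectively (for the induced structures a⋄₁b := pr₁(a⋄b) and α⋄₂β := pr₂(α⋄β)). Set D := D₁ + D₂ and ∇→_a α := pr₂(a⋄α), ∇←_α a := pr₁(α⋄a). Then: (i) D = {x ∈ E : ⟨x,d⟩ = 0 for all d ∈ D} (D is maximal isotropic in E); and (ii) D is closed under the Dorfman bracket ⋄ of E if and only if ∇←_α a ∈ D₁ and ∇→_a α ∈ D₂ for all a ∈ D₁ and α ∈ D₂. -/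
/-- Given Dirac structures `D₁ ⊆ E₁` and `D₂ ⊆ E₂` (for the induced brackets
`⋄₁ := pr₁(·⋄·)` and `⋄₂ := pr₂(·⋄·)`), the sum `D := D₁ + D₂` is maximal isotropic
in `E`, and it is closed under the Dorfman bracket of `E` iff `∇←_α a ∈ D₁` and
`∇→_a α ∈ D₂` for all `a ∈ D₁`, `α ∈ D₂`. -/
theorem matched_sum_of_Dirac_structures
    {A : Type*} [CommRing A] [Algebra ℝ A]
    {E : Type*} [AddCommGroup E] [Module ℝ E] [Module A E] [IsScalarTower ℝ A E]
    (C : CourantAlgebroid A E) (S : OrthSplitting C)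
    (D₁ D₂ : Submodule A E)
    (hD₁ : ∀ x : E, x ∈ D₁ ↔ x ∈ S.E₁ ∧ ∀ d ∈ D₁, C.ip x d = 0)
    (hD₂ : ∀ x : E, x ∈ D₂ ↔ x ∈ S.E₂ ∧ ∀ d ∈ D₂, C.ip x d = 0)
    (hD₁cl : ∀ a ∈ D₁, ∀ b ∈ D₁, S.pr₁ (C.dia a b) ∈ D₁)
    (hD₂cl : ∀ α ∈ D₂, ∀ β ∈ D₂, S.pr₂ (C.dia α β) ∈ D₂) :
    (∀ x : E, x ∈ D₁ ⊔ D₂ ↔ ∀ d ∈ D₁ ⊔ D₂, C.ip x d = 0) ∧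
    ((∀ x ∈ D₁ ⊔ D₂, ∀ y ∈ D₁ ⊔ D₂, C.dia x y ∈ D₁ ⊔ D₂)
      ↔ (∀ a ∈ D₁, ∀ α ∈ D₂,
          S.pr₁ (C.dia α a) ∈ D₁ ∧ S.pr₂ (C.dia a α) ∈ D₂)) := by
  have hE12 : ∀ x ∈ S.E₁, ∀ y ∈ S.E₂, C.ip x y = 0 := fun x hx y hy =>
    (S.mem_E₂_iff y).1 hy x hx
  have hE21 : ∀ x ∈ S.E₂, ∀ y ∈ S.E₁, C.ip x y = 0 := fun x hx y hy =>
    (S.mem_E₁_iff y).1 hy x hx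
  have d1 : ∀ x ∈ D₁, x ∈ S.E₁ := fun x hx => ((hD₁ x).1 hx).1
  have d2 : ∀ x ∈ D₂, x ∈ S.E₂ := fun x hx => ((hD₂ x).1 hx).1
  have ip1 : ∀ x, ∀ y ∈ S.E₁, C.ip (S.pr₁ x) y = C.ip x y := by
    intro x y hy
    conv_rhs => rw [← S.pr_sum x]
    rw [map_add, LinearMap.add_apply, hE21 _ (S.pr₂_mem x) y hy, add_zero]
  have ip2 : ∀ x, ∀ y ∈ S.E₂, C.ip (S.pr₂ x) y = C.ip x y := by
    intro x y hy
    conv_rhs => rw [← S.pr_sum x]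
    rw [map_add, LinearMap.add_apply, hE12 _ (S.pr₁_mem x) y hy, zero_add]
  have main : ∀ x : E, x ∈ D₁ ⊔ D₂ ↔ ∀ d ∈ D₁ ⊔ D₂, C.ip x d = 0 := by
    intro x
    constructor
    · intro hx d hd
      obtain ⟨a, ha, α, hα, rfl⟩ := Submodule.mem_sup.1 hx
      obtain ⟨b, hb, β, hβ, rfl⟩ := Submodule.mem_sup.1 hd
      simp only [map_add, LinearMap.add_apply]
      rw [((hD₁ a).1 ha).2 b hb, ((hD₂ α).1 hα).2 β hβ,
        hE12 a (d1 a ha) β (d2 β hβ), hE21 α (d2 α hα) b (d1 b hb)]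
      simp
    · intro h
      rw [← S.pr_sum x]
      refine Submodule.add_mem_sup ((hD₁ _).2 ⟨S.pr₁_mem x, fun d hd => ?_⟩)
        ((hD₂ _).2 ⟨S.pr₂_mem x, fun d hd => ?_⟩)
      · rw [ip1 x d (d1 d hd)]
        exact h d (Submodule.mem_sup_left hd)
      · rw [ip2 x d (d2 d hd)]
        exact h d (Submodule.mem_sup_right hd)
  have skew12 : ∀ x y, C.ip x x = 0 → C.ip y y = 0 → C.ip x y = 0 →
      C.dia x y = - C.dia y x := by
    intro x y hx hy hxy
    have h := C.sym_part (x + y)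
    have h1 := C.sym_part x
    have h2 := C.sym_part y
    have hyx : C.ip y x = 0 := by rw [C.ip_symm, hxy]
    simp only [map_add, LinearMap.add_apply, hx, hy, hxy, hyx, map_zero, smul_zero,
      add_zero] at h h1 h2
    rw [h1, h2] at h
    simp only [zero_add, add_zero] at h
    first
      | exact eq_neg_of_add_eq_zero_left h
      | exact eq_neg_of_add_eq_zero_right h
  have skew23 : ∀ x y z, C.ip y y = 0 → C.ip z z = 0 → C.ip y z = 0 →
      C.ip (C.dia x y) z = - C.ip (C.dia x z) y := by
    intro x y z hy hz hyz
    have h := C.ad_invar x (y + z)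
    have h1 := C.ad_invar x y
    have h2 := C.ad_invar x z
    have hzy : C.ip z y = 0 := by rw [C.ip_symm, hyz]
    simp only [map_add, LinearMap.add_apply, hy, hz, hyz, hzy, map_zero, add_zero] at h h1 h2
    have h3 : (2 : A) * (C.ip (C.dia x y) z + C.ip (C.dia x z) y) = 0 := by
      linear_combination h1 + h2 - h
    have h4 : (algebraMap ℝ A 2⁻¹) * 2 = 1 := by
      rw [← map_ofNat (algebraMap ℝ A) 2, ← map_mul]
      norm_num
    linear_combination (algebraMap ℝ A 2⁻¹) * h3 -
      (C.ip (C.dia x y) z + C.ip (C.dia x z) y) * h4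
  have iso : ∀ x ∈ D₁ ⊔ D₂, ∀ y ∈ D₁ ⊔ D₂, C.ip x y = 0 := fun x hx => (main x).1 hx
  refine ⟨main, ?_, ?_⟩
  · intro h a ha α hα
    have ha' : a ∈ D₁ ⊔ D₂ := Submodule.mem_sup_left ha
    have hα' : α ∈ D₁ ⊔ D₂ := Submodule.mem_sup_right hα
    refine ⟨(hD₁ _).2 ⟨S.pr₁_mem _, fun d hd => ?_⟩, (hD₂ _).2 ⟨S.pr₂_mem _, fun d hd => ?_⟩⟩
    · rw [ip1 _ d (d1 d hd)]
      exact iso _ (h _ hα' _ ha') d (Submodule.mem_sup_left hd)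
    · rw [ip2 _ d (d2 d hd)]
      exact iso _ (h _ ha' _ hα') d (Submodule.mem_sup_right hd)
  · intro h
    have sk12 : ∀ x ∈ D₁ ⊔ D₂, ∀ y ∈ D₁ ⊔ D₂, C.dia x y = - C.dia y x :=
      fun x hx y hy => skew12 x y (iso x hx x hx) (iso y hy y hy) (iso x hx y hy)
    have sk23 : ∀ x, ∀ y ∈ D₁ ⊔ D₂, ∀ z ∈ D₁ ⊔ D₂,
        C.ip (C.dia x y) z = - C.ip (C.dia x z) y :=
      fun x y hy z hz => skew23 x y z (iso y hy y hy) (iso z hz z hz) (iso y hy z hz)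
    have l1 : ∀ a ∈ D₁, a ∈ D₁ ⊔ D₂ := fun a ha => Submodule.mem_sup_left ha
    have l2 : ∀ a ∈ D₂, a ∈ D₁ ⊔ D₂ := fun a ha => Submodule.mem_sup_right ha
    have m21 : ∀ a ∈ D₁, ∀ α ∈ D₂, C.dia α a ∈ D₁ ⊔ D₂ := by
      intro a ha α hα
      rw [← S.pr_sum (C.dia α a)]
      refine Submodule.add_mem_sup (h a ha α hα).1 ?_
      rw [sk12 α (l2 α hα) a (l1 a ha), map_neg]
      exact neg_mem (h a ha α hα).2
    have m12 : ∀ a ∈ D₁, ∀ α ∈ D₂, C.dia a α ∈ D₁ ⊔ D₂ := by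
      intro a ha α hα
      rw [sk12 a (l1 a ha) α (l2 α hα)]
      exact neg_mem (m21 a ha α hα)
    have m11 : ∀ a ∈ D₁, ∀ b ∈ D₁, C.dia a b ∈ D₁ ⊔ D₂ := by
      intro a ha b hb
      rw [← S.pr_sum (C.dia a b)]
      refine Submodule.add_mem_sup (hD₁cl a ha b hb)
        ((hD₂ _).2 ⟨S.pr₂_mem _, fun d hd => ?_⟩)
      rw [ip2 _ d (d2 d hd), sk23 a b (l1 b hb) d (l2 d hd),
        iso _ (m12 a ha d hd) b (l1 b hb), neg_zero]
    have m22 : ∀ a ∈ D₂, ∀ b ∈ D₂, C.dia a b ∈ D₁ ⊔ D₂ := by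
      intro a ha b hb
      rw [← S.pr_sum (C.dia a b)]
      refine Submodule.add_mem_sup
        ((hD₁ _).2 ⟨S.pr₁_mem _, fun d hd => ?_⟩) (hD₂cl a ha b hb)
      rw [ip1 _ d (d1 d hd), sk23 a b (l2 b hb) d (l1 d hd),
        iso _ (m21 d hd a ha) b (l2 b hb), neg_zero]
    intro x hx y hy
    obtain ⟨a, ha, α, hα, rfl⟩ := Submodule.mem_sup.1 hx
    obtain ⟨b, hb, β, hβ, rfl⟩ := Submodule.mem_sup.1 hy
    simp only [map_add, LinearMap.add_apply]
    have q1 := m11 a ha b hb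
    have q2 := m12 a ha β hβ
    have q3 := m21 b hb α hα
    have q4 := m22 α hα β hβ
    first
      | exact add_mem (add_mem q1 q3) (add_mem q2 q4)
      | exact add_mem (add_mem q1 q2) (add_mem q3 q4)
end

section
/- Let E be a Courant algebroid over A (algebraic form) with an orthogonal splitting E = E₁ ⊕ E₂, let D₁ ⊆ E₁, D₂ ⊆ E₂ be Dirac structures (for the induced brackets ⋄₁, ⋄₂), and assume ∇←_α a := pr₁(α⋄a) ∈ D₁ and ∇→_a α := pr₂(a⋄α) ∈ D₂ for all a ∈ D₁, α ∈ D₂ (i.e., (D₁,D₂) is a matched pair of Dirac structures). Then D := D₁ + D₂ with the restricted Dorfman bracket and anchor is a Lie algebroid over A (algebraic form): for all d, d', d'' ∈ D and f ∈ A, d⋄d' ∈ D, d⋄d' = −(d'⋄d), d⋄(d'⋄d'') = (d⋄d')⋄d'' + d'⋄(d⋄d''), and d⋄(f·d') = (ρ(d)f)·d' + f·(d⋄d'). -/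
/-- A matched pair of Dirac structures `(D₁, D₂)` gives a Lie algebroid
(algebraic form) structure on `D := D₁ + D₂` with the restricted Dorfman bracket and
anchor: `D` is closed under the bracket, which is skew-symmetric on `D` and satisfies
the Jacobi identity and the Leibniz rule. -/
theorem matched_pair_of_Dirac_structures_lie_algebroid
    {A : Type*} [CommRing A] [Algebra ℝ A]
    {E : Type*} [AddCommGroup E] [Module ℝ E] [Module A E] [IsScalarTower ℝ A E]
    (C : CourantAlgebroid A E) (S : OrthSplitting C)
    (D₁ D₂ : Submodule A E)
    (hD₁ : ∀ x : E, x ∈ D₁ ↔ x ∈ S.E₁ ∧ ∀ d ∈ D₁, C.ip x d = 0)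
    (hD₂ : ∀ x : E, x ∈ D₂ ↔ x ∈ S.E₂ ∧ ∀ d ∈ D₂, C.ip x d = 0)
    (hD₁cl : ∀ a ∈ D₁, ∀ b ∈ D₁, S.pr₁ (C.dia a b) ∈ D₁)
    (hD₂cl : ∀ α ∈ D₂, ∀ β ∈ D₂, S.pr₂ (C.dia α β) ∈ D₂)
    (hmatch₁ : ∀ α ∈ D₂, ∀ a ∈ D₁, S.pr₁ (C.dia α a) ∈ D₁)
    (hmatch₂ : ∀ a ∈ D₁, ∀ α ∈ D₂, S.pr₂ (C.dia a α) ∈ D₂) :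
    (∀ d ∈ D₁ ⊔ D₂, ∀ d' ∈ D₁ ⊔ D₂, C.dia d d' ∈ D₁ ⊔ D₂) ∧
    (∀ d ∈ D₁ ⊔ D₂, ∀ d' ∈ D₁ ⊔ D₂, C.dia d d' = - C.dia d' d) ∧
    (∀ d ∈ D₁ ⊔ D₂, ∀ d' ∈ D₁ ⊔ D₂, ∀ d'' ∈ D₁ ⊔ D₂,
      C.dia d (C.dia d' d'') = C.dia (C.dia d d') d'' + C.dia d' (C.dia d d'')) ∧
    (∀ d ∈ D₁ ⊔ D₂, ∀ d' ∈ D₁ ⊔ D₂, ∀ f : A,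
      C.dia d (f • d') = (C.anchor d f) • d' + f • C.dia d d') := by
  have o12 : ∀ a ∈ S.E₁, ∀ b ∈ S.E₂, C.ip a b = 0 := fun a ha b hb =>
    (S.mem_E₂_iff b).1 hb a ha
  have o21 : ∀ b ∈ S.E₂, ∀ a ∈ S.E₁, C.ip b a = 0 := fun b hb a ha =>
    (S.mem_E₁_iff a).1 ha b hb
  have iso : ∀ d ∈ D₁ ⊔ D₂, ∀ d' ∈ D₁ ⊔ D₂, C.ip d d' = 0 := by
    intro d hd d' hd'
    obtain ⟨a, ha, α, hα, rfl⟩ := Submodule.mem_sup.1 hd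
    obtain ⟨b, hb, β, hβ, rfl⟩ := Submodule.mem_sup.1 hd'
    have h1 := ((hD₁ a).1 ha).2 b hb
    have h2 := ((hD₂ α).1 hα).2 β hβ
    have h3 := o12 a ((hD₁ a).1 ha).1 β ((hD₂ β).1 hβ).1
    have h4 := o21 α ((hD₂ α).1 hα).1 b ((hD₁ b).1 hb).1
    simp only [map_add, LinearMap.add_apply, h1, h2, h3, h4, add_zero]
  have self0 : ∀ d ∈ D₁ ⊔ D₂, C.dia d d = 0 := by
    intro d hd
    rw [C.sym_part, iso d hd d hd, map_zero, smul_zero]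
  have skew : ∀ d ∈ D₁ ⊔ D₂, ∀ d' ∈ D₁ ⊔ D₂, C.dia d d' = - C.dia d' d := by
    intro d hd d' hd'
    have h := self0 (d + d') (add_mem hd hd')
    simp only [map_add, LinearMap.add_apply, self0 d hd, self0 d' hd', zero_add, add_zero] at h
    first
      | exact eq_neg_of_add_eq_zero_left h
      | exact eq_neg_of_add_eq_zero_right h
  have inv0 : ∀ φ : E, ∀ x ∈ D₁ ⊔ D₂, C.ip (C.dia φ x) x = 0 := by
    intro φ x hx
    have h := C.ad_invar φ x
    rw [iso x hx x hx, map_zero] at h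
    have h2 : (2 : ℝ) • C.ip (C.dia φ x) x = 0 := by
      rw [two_smul, ← two_mul]; exact h.symm
    have h3 := congrArg (fun t => (2⁻¹ : ℝ) • t) h2
    simpa [smul_smul] using h3
  have inv : ∀ φ : E, ∀ x ∈ D₁ ⊔ D₂, ∀ y ∈ D₁ ⊔ D₂,
      C.ip (C.dia φ x) y = - C.ip (C.dia φ y) x := by
    intro φ x hx y hy
    have h := inv0 φ (x + y) (add_mem hx hy)
    have h1 := inv0 φ x hx
    have h2 := inv0 φ y hy
    simp only [map_add, LinearMap.add_apply] at h
    linear_combination h - h1 - h2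
  have m1 : ∀ a ∈ D₁, a ∈ D₁ ⊔ D₂ := fun a ha => Submodule.mem_sup_left ha
  have m2 : ∀ a ∈ D₂, a ∈ D₁ ⊔ D₂ := fun a ha => Submodule.mem_sup_right ha
  have ip1 : ∀ x : E, ∀ a ∈ D₁, C.ip x a = C.ip (S.pr₁ x) a := by
    intro x a ha
    have h := o21 _ (S.pr₂_mem x) a ((hD₁ a).1 ha).1
    conv_lhs => rw [← S.pr_sum x]
    rw [map_add, LinearMap.add_apply, h, add_zero]
  have ip2 : ∀ x : E, ∀ a ∈ D₂, C.ip x a = C.ip (S.pr₂ x) a := by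
    intro x a ha
    have h := o12 _ (S.pr₁_mem x) a ((hD₂ a).1 ha).1
    conv_lhs => rw [← S.pr_sum x]
    rw [map_add, LinearMap.add_apply, h, zero_add]
  have c12 : ∀ a ∈ D₁, ∀ α ∈ D₂, C.dia a α ∈ D₁ ⊔ D₂ := by
    intro a ha α hα
    rw [← S.pr_sum (C.dia a α)]
    refine add_mem (m1 _ ?_) (m2 _ (hmatch₂ a ha α hα))
    rw [skew a (m1 a ha) α (m2 α hα), map_neg]
    exact neg_mem (hmatch₁ α hα a ha)
  have c21 : ∀ α ∈ D₂, ∀ a ∈ D₁, C.dia α a ∈ D₁ ⊔ D₂ := by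
    intro α hα a ha
    rw [skew α (m2 α hα) a (m1 a ha)]
    exact neg_mem (c12 a ha α hα)
  have c11 : ∀ a ∈ D₁, ∀ b ∈ D₁, C.dia a b ∈ D₁ ⊔ D₂ := by
    intro a ha b hb
    rw [← S.pr_sum (C.dia a b)]
    refine add_mem (m1 _ (hD₁cl a ha b hb)) (m2 _ ((hD₂ _).2 ⟨S.pr₂_mem _, ?_⟩))
    intro γ hγ
    rw [← ip2 _ γ hγ, inv a b (m1 b hb) γ (m2 γ hγ), iso _ (c12 a ha γ hγ) b (m1 b hb), neg_zero]
  have c22 : ∀ a ∈ D₂, ∀ b ∈ D₂, C.dia a b ∈ D₁ ⊔ D₂ := by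
    intro a ha b hb
    rw [← S.pr_sum (C.dia a b)]
    refine add_mem (m1 _ ((hD₁ _).2 ⟨S.pr₁_mem _, ?_⟩)) (m2 _ (hD₂cl a ha b hb))
    intro γ hγ
    rw [← ip1 _ γ hγ, inv a b (m2 b hb) γ (m1 γ hγ), iso _ (c21 a ha γ hγ) b (m2 b hb), neg_zero]
  refine ⟨?_, skew, fun d _ d' _ d'' _ => C.jacobi d d' d'', fun d _ d' _ f => C.leibniz d d' f⟩
  intro d hd d' hd'
  obtain ⟨a, ha, α, hα, rfl⟩ := Submodule.mem_sup.1 hd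
  obtain ⟨b, hb, β, hβ, rfl⟩ := Submodule.mem_sup.1 hd'
  simp only [map_add, LinearMap.add_apply]
  have h1 := c11 a ha b hb
  have h2 := c22 α hα β hβ
  have h3 := c12 a ha β hβ
  have h4 := c21 α hα b hb
  first
    | exact add_mem (add_mem h1 h4) (add_mem h3 h2)
    | exact add_mem (add_mem h1 h3) (add_mem h4 h2)
end
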